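/- Let ℓ ≥ 4 be an integer and d a positive integer, and set s = ⌊(ℓ−2)/2⌋. For i = 1,…,2^d + 1 let τ_i ∈ Δ_ℓ be the polygonal curve with vertex sequence (0, s(i−1)+1, s(i−1)+1/2, s(i−1)+2, s(i−1)+3/2, …, si, si − 1/2, s(2^d + 2)). Then d_F(τ_i, c) ≤ 1/4 for all i, where c ∈ Δ_ℓ is the segment with vertex sequence (0, s(2^d + 2)), and no two distinct τ_i, τ_j are contained in a common ball of radius 1/8 whose center lies in Δ_ℓ. Consequently, for every integer ℓ ≥ 4 and every positive integer d, there is a closed ball of radius 1/4 in (Δ_ℓ, d_F) that cannot be covered by 2^d closed balls of radius 1/8 with centers in Δ_ℓ; hence the doubling dimension of (Δ_ℓ, d_F) is unbounded for every ℓ ≥ 4. -/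

import Mathlib

open Set

/-- A valid reparametrization of `[0,1]`: a continuous strictly increasing
bijection of `[0,1]` onto itself fixing the endpoints. -/
def IsReparam (f : ℝ → ℝ) : Prop :=
  ContinuousOn f (Set.Icc 0 1) ∧ StrictMonoOn f (Set.Icc 0 1) ∧ f 0 = 0 ∧ f 1 = 1

/-- The Fréchet distance between two curves `τ, π : [0,1] → ℝ`:
`inf_f sup_{t ∈ [0,1]} |τ(f(t)) - π(t)|` over reparametrizations `f`. -/
noncomputable def frechetDist (τ π : ℝ → ℝ) : ℝ :=
  ⨅ f : {f : ℝ → ℝ // IsReparam f}, ⨆ t : Set.Icc (0:ℝ) 1, |τ (f.1 ↑t) - π ↑t|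

/-- `τ` is the polygonal curve on `[0,1]` with the `m` vertices `w 0, …, w (m-1)`
attained at parameters `t 0 = 0 < t 1 < … < t (m-1) = 1`, obtained by linear
interpolation. -/
def IsPolyOn (τ : ℝ → ℝ) (m : ℕ) (t w : ℕ → ℝ) : Prop :=
  2 ≤ m ∧ t 0 = 0 ∧ t (m - 1) = 1 ∧ (∀ i, i + 1 < m → t i < t (i + 1)) ∧
  (∀ i, i + 1 < m → ∀ u ∈ Set.Icc (t i) (t (i + 1)),
    τ u = w i + (u - t i) / (t (i + 1) - t i) * (w (i + 1) - w i))

/-- `τ` is a polygonal curve (with finitely many vertices). -/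
def IsPolyCurve (τ : ℝ → ℝ) : Prop := ∃ m t w, IsPolyOn τ m t w

/-- `c` is a polygonal curve with at most `ℓ` vertices, i.e. an element of `Δ_ℓ`. -/
def InDeltaL (ℓ : ℕ) (c : ℝ → ℝ) : Prop := ∃ m t w, m ≤ ℓ ∧ IsPolyOn c m t w

/-- General position of the vertex sequence `w 0, …, w (m-1)`: pairwise distinct
vertex values, pairwise distinct differences, and no vertex inside the closed
interval spanned by its two neighbours. -/
def GenPos (m : ℕ) (w : ℕ → ℝ) : Prop :=
  (∀ i j, i < m → j < m → i ≠ j → w i ≠ w j) ∧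
  (∀ i j p q, i < m → j < m → p < m → q < m → i ≠ j → p ≠ q →
      (i, j) ≠ (p, q) → w i - w j ≠ w p - w q) ∧
  (∀ i, i + 2 < m → w (i + 1) ∉ Set.uIcc (w i) (w (i + 2)))

/-- The parameters `s 0 = 0 < s 1 < … < s (ℓ-1) = 1` define a `δ`-signature of the
curve `τ` (Definition 3.3 of the paper, `0`-indexed): non-degeneracy,
direction-preservation, minimum edge length and range conditions. -/
def IsSignature (δ : ℝ) (τ : ℝ → ℝ) (ℓ : ℕ) (s : ℕ → ℝ) : Prop :=
  2 ≤ ℓ ∧ s 0 = 0 ∧ s (ℓ - 1) = 1 ∧ (∀ i, i + 1 < ℓ → s i < s (i + 1)) ∧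
  (∀ i, 1 ≤ i → i + 1 < ℓ → τ (s i) ∉ Set.uIcc (τ (s (i - 1))) (τ (s (i + 1)))) ∧
  (∀ i, i + 1 < ℓ → ∀ a b : ℝ, s i ≤ a → a < b → b ≤ s (i + 1) →
      (τ (s i) < τ (s (i + 1)) → τ a - τ b ≤ 2 * δ) ∧
      (τ (s (i + 1)) < τ (s i) → τ b - τ a ≤ 2 * δ)) ∧
  (∀ i, 1 ≤ i → i + 3 ≤ ℓ → 2 * δ < |τ (s (i + 1)) - τ (s i)|) ∧
  δ < |τ (s 1) - τ (s 0)| ∧ δ < |τ (s (ℓ - 1)) - τ (s (ℓ - 2))| ∧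
  (∀ i, 1 ≤ i → i + 3 ≤ ℓ → ∀ a ∈ Set.Icc (s i) (s (i + 1)),
      τ a ∈ Set.uIcc (τ (s i)) (τ (s (i + 1)))) ∧
  (2 < ℓ → ∀ a ∈ Set.Icc (s 0) (s 1),
      τ a ∈ Set.uIcc (τ (s 0)) (τ (s 1)) ∪ Set.Icc (τ (s 0) - δ) (τ (s 0) + δ)) ∧
  (2 < ℓ → ∀ a ∈ Set.Icc (s (ℓ - 2)) (s (ℓ - 1)),
      τ a ∈ Set.uIcc (τ (s (ℓ - 2))) (τ (s (ℓ - 1))) ∪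
        Set.Icc (τ (s (ℓ - 1)) - δ) (τ (s (ℓ - 1)) + δ)) ∧
  (ℓ = 2 → ∀ a ∈ Set.Icc (s 0) (s 1),
      τ a ∈ Set.uIcc (τ (s 0)) (τ (s 1)) ∪ Set.Icc (τ (s 0) - δ) (τ (s 0) + δ) ∪
        Set.Icc (τ (s 1) - δ) (τ (s 1) + δ))

/-- The affine interpolation of the vertices `w 0, …, w n` at the parameters `t 0 < … < t n`,
extended by constants outside `[t 0, t n]`. -/
noncomputable def interpolant (n : ℕ) (t w : ℕ → ℝ) (u : ℝ) : ℝ :=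
  w 0 + ∑ i ∈ Finset.range n, (w (i + 1) - w i) * max 0 (min 1 ((u - t i) / (t (i + 1) - t i)))

theorem continuous_interpolant (n : ℕ) (t w : ℕ → ℝ) : Continuous (interpolant n t w) := by
  unfold interpolant
  fun_prop

theorem exists_edge_mem {n : ℕ} {t : ℕ → ℝ} {u : ℝ} (hn : 0 < n) (h0 : t 0 ≤ u) (h1 : u ≤ t n) :
    ∃ v < n, u ∈ Icc (t v) (t (v + 1)) := by
  induction n with
  | zero => omega
  | succ n ih =>
    by_cases hu : t n ≤ u
    · exact ⟨n, by omega, hu, h1⟩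
    · rcases Nat.eq_zero_or_pos n with rfl | hn'
      · exact absurd h0 hu
      · obtain ⟨v, hv, hm⟩ := ih hn' (not_le.mp hu).le
        exact ⟨v, by omega, hm⟩

theorem knots_strictMono {n : ℕ} {t : ℕ → ℝ} (ht : ∀ i < n, t i < t (i + 1)) {a b : ℕ}
    (hab : a < b) (hb : b ≤ n) : t a < t b := by
  induction b with
  | zero => omega
  | succ b ih =>
    rcases Nat.lt_succ_iff_lt_or_eq.mp hab with h | rfl
    · exact (ih h (by omega)).trans (ht b (by omega))
    · exact ht a (by omega)

theorem knots_mono {n : ℕ} {t : ℕ → ℝ} (ht : ∀ i < n, t i < t (i + 1)) {a b : ℕ}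
    (hab : a ≤ b) (hb : b ≤ n) : t a ≤ t b := by
  rcases hab.eq_or_lt with rfl | h
  · exact le_rfl
  · exact (knots_strictMono ht h hb).le

theorem interpolant_eq_on_edge {n : ℕ} {t : ℕ → ℝ} (w : ℕ → ℝ) (ht : ∀ i < n, t i < t (i + 1))
    {i : ℕ} (hi : i < n) {u : ℝ} (hu : u ∈ Icc (t i) (t (i + 1))) :
    interpolant n t w u = w i + (u - t i) / (t (i + 1) - t i) * (w (i + 1) - w i) := by
  have hterm : ∀ j ∈ Finset.range n,
      (w (j + 1) - w j) * max 0 (min 1 ((u - t j) / (t (j + 1) - t j))) =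
        if j < i then w (j + 1) - w j
        else if j = i then (u - t i) / (t (i + 1) - t i) * (w (i + 1) - w i) else 0 := by
    intro j hj
    have hj := Finset.mem_range.mp hj
    have hpos : 0 < t (j + 1) - t j := sub_pos.mpr (ht j hj)
    rcases lt_trichotomy j i with h | rfl | h
    · have h1 : 1 ≤ (u - t j) / (t (j + 1) - t j) := by
        rw [le_div_iff₀ hpos]
        linarith [hu.1, knots_mono ht (show j + 1 ≤ i by omega) hi.le]
      simp [h, min_eq_left h1]
    · have h0 : 0 ≤ (u - t j) / (t (j + 1) - t j) := div_nonneg (by linarith [hu.1]) hpos.le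
      have h1 : (u - t j) / (t (j + 1) - t j) ≤ 1 := by
        rw [div_le_one hpos]
        linarith [hu.2]
      simp [min_eq_right h1, max_eq_right h0, mul_comm]
    · have h0 : (u - t j) / (t (j + 1) - t j) ≤ 0 :=
        div_nonpos_of_nonpos_of_nonneg
          (by linarith [hu.2, knots_mono ht (show i + 1 ≤ j by omega) hj.le]) hpos.le
      have hmin : min 1 ((u - t j) / (t (j + 1) - t j)) ≤ 0 := (min_le_right _ _).trans h0
      simp [max_eq_left hmin, h.not_gt, h.ne']
  have hsum : ∀ k, k ≤ i → ∑ j ∈ Finset.range k, (if j < i then w (j + 1) - w j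
        else if j = i then (u - t i) / (t (i + 1) - t i) * (w (i + 1) - w i) else 0) =
      w k - w 0 := by
    intro k
    induction k with
    | zero => simp
    | succ k ih =>
      intro hk
      rw [Finset.sum_range_succ, ih (by omega), if_pos (by omega)]
      ring
  have htail : ∀ k, i + 1 + k ≤ n → ∑ j ∈ Finset.range (i + 1 + k),
        (if j < i then w (j + 1) - w j
        else if j = i then (u - t i) / (t (i + 1) - t i) * (w (i + 1) - w i) else 0) =
      w i - w 0 + (u - t i) / (t (i + 1) - t i) * (w (i + 1) - w i) := by
    intro k
    induction k with
    | zero =>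
      intro _
      rw [add_zero, Finset.sum_range_succ, hsum i le_rfl]
      simp
    | succ k ih =>
      intro hk
      rw [← add_assoc, Finset.sum_range_succ, ih (by omega), if_neg (by omega),
        if_neg (by omega), add_zero]
  have h := htail (n - (i + 1)) (by omega)
  rw [show i + 1 + (n - (i + 1)) = n by omega] at h
  rw [interpolant, Finset.sum_congr rfl hterm, h]
  ring

theorem interpolant_strictMonoOn {n : ℕ} {t w : ℕ → ℝ}
    (ht : ∀ i < n, t i < t (i + 1)) (hw : ∀ i < n, w i < w (i + 1)) :
    StrictMonoOn (interpolant n t w) (Icc (t 0) (t n)) := by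
  have hmono : Monotone (interpolant n t w) := by
    intro x y hxy
    unfold interpolant
    gcongr with i hi
    · exact sub_nonneg.mpr (hw i (Finset.mem_range.mp hi)).le
    · exact sub_nonneg.mpr (ht i (Finset.mem_range.mp hi)).le
  intro x hx y hy hxy
  obtain ⟨v, hv, hxv⟩ : ∃ v < n, x ∈ Icc (t v) (t (v + 1)) ∧ x < t (v + 1) := by
    by_contra! hcon
    have hall : ∀ v ≤ n, t v ≤ x := by
      intro v
      induction v with
      | zero => exact fun _ => hx.1
      | succ v ih =>
        intro hv
        by_contra! hlt
        exact absurd (hcon v (by omega) ⟨ih (by omega), hlt.le⟩) (not_le.mpr hlt)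
    exact absurd (hall n le_rfl) (not_le.mpr (hxy.trans_le hy.2))
  have hpos : 0 < t (v + 1) - t v := sub_pos.mpr (ht v hv)
  have hmid : x < min y (t (v + 1)) := lt_min hxy hxv.2
  calc interpolant n t w x < interpolant n t w (min y (t (v + 1))) := by
        rw [interpolant_eq_on_edge w ht hv hxv.1,
          interpolant_eq_on_edge w ht hv ⟨hxv.1.1.trans hmid.le, min_le_right _ _⟩]
        have := hw v hv
        gcongr
    _ ≤ interpolant n t w y := hmono (min_le_left _ _)

namespace IsPolyOn

variable {σ : ℝ → ℝ} {m : ℕ} {t w : ℕ → ℝ}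

theorem knots_lt (h : IsPolyOn σ m t w) : ∀ i < m - 1, t i < t (i + 1) :=
  fun i hi => h.2.2.2.1 i (by omega)

theorem knot_mem (h : IsPolyOn σ m t w) {v : ℕ} (hv : v < m) : t v ∈ Icc (0 : ℝ) 1 := by
  rw [← h.2.1, ← h.2.2.1]
  exact ⟨knots_mono h.knots_lt (Nat.zero_le v) (by omega),
    knots_mono h.knots_lt (by omega) le_rfl⟩

theorem exists_edge (h : IsPolyOn σ m t w) {u : ℝ} (hu : u ∈ Icc (0 : ℝ) 1) :
    ∃ v, v + 1 < m ∧ u ∈ Icc (t v) (t (v + 1)) := by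
  have hm := h.1
  rw [← h.2.1, ← h.2.2.1] at hu
  obtain ⟨v, hv, hmem⟩ := exists_edge_mem (by omega) hu.1 hu.2
  exact ⟨v, by omega, hmem⟩

theorem eqOn_interpolant (h : IsPolyOn σ m t w) :
    EqOn σ (interpolant (m - 1) t w) (Icc 0 1) := by
  intro u hu
  obtain ⟨v, hv, hmem⟩ := h.exists_edge hu
  rw [h.2.2.2.2 v hv u hmem, interpolant_eq_on_edge w h.knots_lt (by omega) hmem]

theorem continuousOn (h : IsPolyOn σ m t w) : ContinuousOn σ (Icc 0 1) :=
  (continuous_interpolant _ t w).continuousOn.congr h.eqOn_interpolant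

theorem exists_abs_le (h : IsPolyOn σ m t w) : ∃ B, ∀ u ∈ Icc (0 : ℝ) 1, |σ u| ≤ B :=
  isCompact_Icc.exists_bound_of_continuousOn h.continuousOn

theorem apply_knot (h : IsPolyOn σ m t w) {v : ℕ} (hv : v < m) : σ (t v) = w v := by
  have hm := h.1
  by_cases hv' : v + 1 < m
  · rw [h.2.2.2.2 v hv' (t v) ⟨le_rfl, (h.2.2.2.1 v hv').le⟩]
    simp
  · obtain ⟨k, rfl⟩ : ∃ k, v = k + 1 := ⟨v - 1, by omega⟩
    have hlt := h.2.2.2.1 k hv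
    rw [h.2.2.2.2 k hv _ ⟨hlt.le, le_rfl⟩, div_self (sub_pos.mpr hlt).ne']
    ring

theorem le_of_vertices_le (h : IsPolyOn σ m t w) {n : ℕ} (hn : 0 < n) (hnm : n < m) {B : ℝ}
    (hB : ∀ v ≤ n, w v ≤ B) {u : ℝ} (hu : u ∈ Icc 0 (t n)) : σ u ≤ B := by
  rw [← h.2.1] at hu
  obtain ⟨v, hv, hmem⟩ := exists_edge_mem hn hu.1 hu.2
  have hpos : 0 < t (v + 1) - t v := sub_pos.mpr (h.2.2.2.1 v (by omega))
  rw [h.2.2.2.2 v (by omega) u hmem]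
  have h0 : 0 ≤ (u - t v) / (t (v + 1) - t v) := div_nonneg (by linarith [hmem.1]) hpos.le
  have h1 : (u - t v) / (t (v + 1) - t v) ≤ 1 := by
    rw [div_le_one hpos]
    linarith [hmem.2]
  nlinarith [hB v (by omega), hB (v + 1) (by omega)]

theorem neg (h : IsPolyOn σ m t w) : IsPolyOn (fun u => -σ u) m t (fun v => -w v) := by
  refine ⟨h.1, h.2.1, h.2.2.1, h.2.2.2.1, fun i hi u hu => ?_⟩
  beta_reduce
  rw [h.2.2.2.2 i hi u hu]
  ring

theorem exists_increasing_edge (h : IsPolyOn σ m t w) {x y : ℝ} (hx : 0 ≤ x) (hy : y ≤ 1)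
    (hxy : x < y) (hσ : σ x < σ y) :
    ∃ e, e + 1 < m ∧ t e < y ∧ x < t (e + 1) ∧ w e < w (e + 1) := by
  by_contra! hcon
  have key : ∀ n, n + 1 < m → ∀ u, u ∈ Icc (t n) (t (n + 1)) → x < u → u ≤ y → σ u ≤ σ x := by
    intro n
    induction n with
    | zero =>
      intro hn u hu hxu huy
      have hlt := h.2.2.2.1 0 hn
      have hxm : x ∈ Icc (t 0) (t (0 + 1)) := ⟨by rw [h.2.1]; exact hx, hxu.le.trans hu.2⟩
      have hw := hcon 0 hn (hxm.1.trans_lt (hxu.trans_le huy)) (hxu.trans_le hu.2)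
      rw [h.2.2.2.2 0 hn u hu, h.2.2.2.2 0 hn x hxm]
      have : (x - t 0) / (t (0 + 1) - t 0) ≤ (u - t 0) / (t (0 + 1) - t 0) := by
        have := sub_pos.mpr hlt
        gcongr
      nlinarith
    | succ n ih =>
      intro hn u hu hxu huy
      have hlt := h.2.2.2.1 (n + 1) hn
      have hpos := sub_pos.mpr hlt
      have hxt := hxu.trans_le hu.2
      by_cases hxn : t (n + 1) ≤ x
      · have hw := hcon (n + 1) hn (hxn.trans_lt (hxu.trans_le huy)) hxt
        rw [h.2.2.2.2 (n + 1) hn u hu, h.2.2.2.2 (n + 1) hn x ⟨hxn, hxt.le⟩]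
        have : (x - t (n + 1)) / (t (n + 1 + 1) - t (n + 1)) ≤
            (u - t (n + 1)) / (t (n + 1 + 1) - t (n + 1)) := by gcongr
        nlinarith
      · push Not at hxn
        have hprev := ih (by omega) (t (n + 1)) ⟨(h.2.2.2.1 n (by omega)).le, le_rfl⟩ hxn
          (hu.1.trans huy)
        rcases hu.1.eq_or_lt with heq | hlt'
        · rwa [← heq]
        have hw := hcon (n + 1) hn (hlt'.trans_le huy) hxt
        rw [h.apply_knot (by omega)] at hprev
        rw [h.2.2.2.2 (n + 1) hn u hu]
        have : 0 ≤ (u - t (n + 1)) / (t (n + 1 + 1) - t (n + 1)) :=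
          div_nonneg (by linarith) hpos.le
        nlinarith
  obtain ⟨v, hv, hmem⟩ := h.exists_edge ⟨hx.trans hxy.le, hy⟩
  exact absurd (key v hv y hmem hxy le_rfl) (not_le.mpr hσ)

theorem exists_decreasing_edge (h : IsPolyOn σ m t w) {x y : ℝ} (hx : 0 ≤ x) (hy : y ≤ 1)
    (hxy : x < y) (hσ : σ y < σ x) :
    ∃ e, e + 1 < m ∧ t e < y ∧ x < t (e + 1) ∧ w (e + 1) < w e := by
  obtain ⟨e, he, h1, h2, h3⟩ := h.neg.exists_increasing_edge hx hy hxy (neg_lt_neg hσ)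
  exact ⟨e, he, h1, h2, neg_lt_neg_iff.mp h3⟩

/-- A polygonal curve that strictly alternates along `N + 1` points has more than `N` vertices. -/
theorem lt_of_alternating (h : IsPolyOn σ m t w) {N : ℕ} {x : ℕ → ℝ} (hN : 0 < N)
    (hx : ∀ k ≤ N, x k ∈ Icc (0 : ℝ) 1) (hlt : ∀ k < N, x k < x (k + 1))
    (heven : ∀ k < N, k % 2 = 0 → σ (x k) < σ (x (k + 1)))
    (hodd : ∀ k < N, k % 2 = 1 → σ (x (k + 1)) < σ (x k)) : N < m := by
  have edge : ∀ k < N, ∃ e, e + 1 < m ∧ t e < x (k + 1) ∧ x k < t (e + 1) ∧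
      (k % 2 = 0 → w e < w (e + 1)) ∧ (k % 2 = 1 → w (e + 1) < w e) := by
    intro k hk
    have h0 := (hx k hk.le).1
    have h1 := (hx (k + 1) hk).2
    rcases Nat.mod_two_eq_zero_or_one k with hp | hp
    · obtain ⟨e, a, b, c, d⟩ := h.exists_increasing_edge h0 h1 (hlt k hk) (heven k hk hp)
      exact ⟨e, a, b, c, fun _ => d, fun hp' => by omega⟩
    · obtain ⟨e, a, b, c, d⟩ := h.exists_decreasing_edge h0 h1 (hlt k hk) (hodd k hk hp)
      exact ⟨e, a, b, c, fun hp' => by omega, fun _ => d⟩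
  have key : ∀ k < N, ∃ e, k ≤ e ∧ e + 1 < m ∧ t e < x (k + 1) ∧
      (k % 2 = 0 → w e < w (e + 1)) ∧ (k % 2 = 1 → w (e + 1) < w e) := by
    intro k
    induction k with
    | zero =>
      intro hk
      obtain ⟨e, a, b, _, c⟩ := edge 0 hk
      exact ⟨e, Nat.zero_le e, a, b, c⟩
    | succ k ih =>
      intro hk
      obtain ⟨e, hke, he, hte, hinc, hdec⟩ := ih (by omega)
      obtain ⟨e', he', hte', hxe', hinc', hdec'⟩ := edge (k + 1) hk
      refine ⟨e', ?_, he', hte', hinc', hdec'⟩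
      have hle : e ≤ e' := by
        by_contra! hcon
        exact absurd (hte.trans hxe')
          (not_lt.mpr (knots_mono h.knots_lt (show e' + 1 ≤ e by omega) (by omega)))
      have hne : e ≠ e' := by
        rintro rfl
        rcases Nat.mod_two_eq_zero_or_one k with hp | hp
        · exact absurd (hinc hp) (hdec' (by omega)).not_gt
        · exact absurd (hdec hp) (hinc' (by omega)).not_gt
      omega
  obtain ⟨e, hke, he, _⟩ := key (N - 1) (by omega)
  omega

end IsPolyOn

theorem IsReparam.mapsTo {f : ℝ → ℝ} (hf : IsReparam f) : MapsTo f (Icc 0 1) (Icc 0 1) := by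
  intro u hu
  have h0 := hf.2.1.monotoneOn (left_mem_Icc.mpr zero_le_one) hu hu.1
  have h1 := hf.2.1.monotoneOn hu (right_mem_Icc.mpr zero_le_one) hu.2
  rw [hf.2.2.1] at h0
  rw [hf.2.2.2] at h1
  exact ⟨h0, h1⟩

theorem frechetDist_le_of_reparam {σ π f : ℝ → ℝ} {δ : ℝ} (hf : IsReparam f)
    (h : ∀ u ∈ Icc (0 : ℝ) 1, |σ (f u) - π u| ≤ δ) : frechetDist σ π ≤ δ := by
  have : Nonempty (Icc (0 : ℝ) 1) := ⟨⟨0, by simp⟩⟩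
  refine (ciInf_le ⟨0, ?_⟩ (⟨f, hf⟩ : {f : ℝ → ℝ // IsReparam f})).trans
    (ciSup_le fun u => h u u.2)
  rintro _ ⟨g, rfl⟩
  exact Real.iSup_nonneg fun u => abs_nonneg _

theorem isReparam_id : IsReparam id :=
  ⟨continuousOn_id, strictMono_id.strictMonoOn _, rfl, rfl⟩

theorem exists_reparam_of_frechetDist_lt {σ π : ℝ → ℝ} {δ : ℝ}
    (hσ : ∃ B, ∀ u ∈ Icc (0 : ℝ) 1, |σ u| ≤ B) (hπ : ∃ B, ∀ u ∈ Icc (0 : ℝ) 1, |π u| ≤ B)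
    (h : frechetDist σ π < δ) :
    ∃ f, IsReparam f ∧ ∀ u ∈ Icc (0 : ℝ) 1, |σ (f u) - π u| < δ := by
  have : Nonempty {f : ℝ → ℝ // IsReparam f} := ⟨⟨id, isReparam_id⟩⟩
  obtain ⟨⟨f, hf⟩, hlt⟩ := exists_lt_of_ciInf_lt h
  obtain ⟨A, hA⟩ := hσ
  obtain ⟨B, hB⟩ := hπ
  refine ⟨f, hf, fun u hu => lt_of_le_of_lt ?_ hlt⟩
  refine le_ciSup (f := fun u : Icc (0 : ℝ) 1 => |σ (f u) - π u|) ⟨A + B, ?_⟩ ⟨u, hu⟩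
  rintro _ ⟨v, rfl⟩
  exact (abs_sub _ _).trans (add_le_add (hA _ (hf.mapsTo v.2)) (hB _ v.2))

/-- Matching the vertices of two polygonal curves in order bounds their Fréchet distance. -/
theorem IsPolyOn.frechetDist_le {σ π : ℝ → ℝ} {m : ℕ} {t w t' w' : ℕ → ℝ}
    (hσ : IsPolyOn σ m t w) (hπ : IsPolyOn π m t' w') {δ : ℝ}
    (hδ : ∀ v < m, |w v - w' v| ≤ δ) : frechetDist σ π ≤ δ := by
  have hm := hσ.1
  have hedge := fun v (hv : v + 1 < m) u hu =>
    interpolant_eq_on_edge t hπ.knots_lt (show v < m - 1 by omega) (u := u) hu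
  have hf : IsReparam (interpolant (m - 1) t' t) := by
    have hmono := interpolant_strictMonoOn hπ.knots_lt hσ.knots_lt
    rw [hπ.2.1, hπ.2.2.1] at hmono
    have hpoly : IsPolyOn (interpolant (m - 1) t' t) m t' t :=
      ⟨hm, hπ.2.1, hπ.2.2.1, hπ.2.2.2.1, hedge⟩
    refine ⟨(continuous_interpolant _ _ _).continuousOn, hmono, ?_, ?_⟩
    · rw [← hπ.2.1, hpoly.apply_knot (by omega), hσ.2.1, hπ.2.1]
    · rw [← hπ.2.2.1, hpoly.apply_knot (by omega), hσ.2.2.1, hπ.2.2.1]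
  refine frechetDist_le_of_reparam hf fun u hu => ?_
  obtain ⟨v, hv, hmem⟩ := hπ.exists_edge hu
  have hpos : 0 < t (v + 1) - t v := sub_pos.mpr (hσ.2.2.2.1 v hv)
  have hpos' : 0 < t' (v + 1) - t' v := sub_pos.mpr (hπ.2.2.2.1 v hv)
  set r := (u - t' v) / (t' (v + 1) - t' v) with hr
  have h0 : 0 ≤ r := div_nonneg (by linarith [hmem.1]) hpos'.le
  have h1 : r ≤ 1 := by
    rw [hr, div_le_one hpos']
    linarith [hmem.2]
  have hfu : interpolant (m - 1) t' t u = t v + r * (t (v + 1) - t v) := hedge v hv u hmem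
  rw [hfu, hσ.2.2.2.2 v hv _ ⟨by nlinarith, by nlinarith⟩, hπ.2.2.2.2 v hv u hmem, ← hr,
    add_sub_cancel_left, mul_div_assoc, div_self hpos.ne', mul_one]
  have hv0 := abs_le.mp (hδ v (by omega))
  have hv1 := abs_le.mp (hδ (v + 1) hv)
  rw [abs_le]
  constructor <;> nlinarith

/-- The vertices `0, b + 1, b + 1/2, b + 2, b + 3/2, …, b + s, b + s - 1/2, L`. -/
noncomputable def zigzag (s : ℕ) (b L : ℝ) (v : ℕ) : ℝ :=
  if v = 0 then 0
  else if v = 2 * s + 1 then L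
  else if v % 2 = 1 then b + (((v + 1) / 2 : ℕ) : ℝ)
  else b + ((v / 2 : ℕ) : ℝ) - 1 / 2

section zigzag

variable {s : ℕ} {b L : ℝ}

theorem zigzag_zero : zigzag s b L 0 = 0 := by simp [zigzag]

theorem zigzag_last : zigzag s b L (2 * s + 1) = L := by simp [zigzag]

theorem zigzag_peak {k : ℕ} (hk : k < s) : zigzag s b L (2 * k + 1) = b + k + 1 := by
  rw [zigzag, if_neg (by omega), if_neg (by omega), if_pos (by omega),
    show (2 * k + 1 + 1) / 2 = k + 1 by omega]
  push_cast
  ring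

theorem zigzag_valley (k : ℕ) : zigzag s b L (2 * k + 2) = b + k + 1 / 2 := by
  rw [zigzag, if_neg (by omega), if_neg (by omega), if_neg (by omega),
    show (2 * k + 2) / 2 = k + 1 by omega]
  push_cast
  ring

theorem zigzag_index_cases {v : ℕ} (hv : v ≤ 2 * s + 1) :
    v = 0 ∨ v = 2 * s + 1 ∨ ∃ k < s, v = 2 * k + 1 ∨ v = 2 * k + 2 := by
  rcases Nat.eq_zero_or_pos v with h | h
  · exact Or.inl h
  · by_cases hl : v = 2 * s + 1
    · exact Or.inr (Or.inl hl)
    · exact Or.inr (Or.inr ⟨(v - 1) / 2, by omega, by omega⟩)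

theorem zigzag_le (hb : 0 ≤ b) {v : ℕ} (hv : v ≤ 2 * s) : zigzag s b L v ≤ b + s := by
  rcases zigzag_index_cases (show v ≤ 2 * s + 1 by omega) with rfl | rfl | ⟨k, hk, rfl | rfl⟩
  · rw [zigzag_zero]
    positivity
  · omega
  · have : (k : ℝ) + 1 ≤ s := by exact_mod_cast hk
    rw [zigzag_peak hk]
    linarith
  · have : (k : ℝ) + 1 ≤ s := by exact_mod_cast hk
    rw [zigzag_valley k]
    linarith

theorem zigzag_ascent (hs : 0 < s) (hb : 0 ≤ b) (hL : b + s ≤ L) {v : ℕ} (hv : v ≤ 2 * s)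
    (hp : v % 2 = 0) : zigzag s b L v + 1 / 2 ≤ zigzag s b L (v + 1) := by
  rcases zigzag_index_cases (show v ≤ 2 * s + 1 by omega) with rfl | rfl | ⟨k, hk, rfl | rfl⟩
  · rw [zigzag_zero, show 0 + 1 = 2 * 0 + 1 by rfl, zigzag_peak hs]
    push_cast
    linarith
  · omega
  · omega
  · rw [zigzag_valley k]
    by_cases hk' : k + 1 < s
    · rw [show 2 * k + 2 + 1 = 2 * (k + 1) + 1 by ring, zigzag_peak hk']
      push_cast
      linarith
    · obtain rfl : s = k + 1 := by omega
      rw [show 2 * k + 2 + 1 = 2 * (k + 1) + 1 by ring, zigzag_last]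
      push_cast at hL
      linarith

theorem zigzag_descent {v : ℕ} (hv : v < 2 * s) (hp : v % 2 = 1) :
    zigzag s b L (v + 1) + 1 / 2 ≤ zigzag s b L v := by
  rcases zigzag_index_cases (show v ≤ 2 * s + 1 by omega) with rfl | rfl | ⟨k, hk, rfl | rfl⟩
  · omega
  · omega
  · rw [zigzag_peak hk, show 2 * k + 1 + 1 = 2 * k + 2 by ring, zigzag_valley k]
    linarith
  · omega

/-- Strictly increasing values that stay within `1 / 4 + η` of the zigzag vertices. -/
theorem exists_increasing_near_zigzag (hs : 0 < s) (hb : 0 ≤ b) (hL : b + s ≤ L) {η : ℝ}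
    (hη : 0 < η) (hη' : η ≤ 1 / 8) :
    ∃ h : ℕ → ℝ, h 0 = 0 ∧ h (2 * s + 1) = L ∧ (∀ v ≤ 2 * s, h v < h (v + 1)) ∧
      ∀ v ≤ 2 * s + 1, |zigzag s b L v - h v| ≤ 1 / 4 + η := by
  refine ⟨fun v => if v = 0 then 0 else if v = 2 * s + 1 then L
    else if v % 2 = 1 then zigzag s b L v - 1 / 4 - η else zigzag s b L v + 1 / 4 + η,
    by simp, by simp, ?_, ?_⟩
  · intro v hv
    rcases zigzag_index_cases (show v ≤ 2 * s + 1 by omega) with rfl | rfl | ⟨k, hk, rfl | rfl⟩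
    · have := zigzag_peak (b := b) (L := L) hs
      simp only [mul_zero, zero_add, Nat.cast_zero, add_zero] at this
      simp [this, hs.ne']
      linarith
    · omega
    · beta_reduce
      rw [if_neg (by omega), if_neg (by omega), if_pos (by omega), if_neg (by omega),
        if_neg (by omega), if_neg (by omega), zigzag_peak hk,
        show 2 * k + 1 + 1 = 2 * k + 2 by ring, zigzag_valley k]
      linarith
    · beta_reduce
      rw [if_neg (by omega), if_neg (by omega), if_neg (by omega), if_neg (by omega),
        zigzag_valley k]
      by_cases hk' : k + 1 < s
      · rw [if_neg (by omega), if_pos (by omega),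
          show 2 * k + 2 + 1 = 2 * (k + 1) + 1 by ring, zigzag_peak hk']
        push_cast
        linarith
      · rw [if_pos (by omega)]
        obtain rfl : s = k + 1 := by omega
        push_cast at hL
        linarith
  · intro v _
    beta_reduce
    split_ifs with h0 h1 h2
    · subst h0
      rw [zigzag_zero]
      simp
      positivity
    · subst h1
      rw [zigzag_last]
      simp
      positivity
    · rw [abs_le]
      constructor <;> linarith
    · rw [abs_le]
      constructor <;> linarith

variable {σ c : ℝ → ℝ} {t : ℕ → ℝ}

theorem frechetDist_zigzag_segment_le (hs : 0 < s) (hb : 0 ≤ b) (hL : b + s ≤ L)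
    (hσ : IsPolyOn σ (2 * s + 2) t (zigzag s b L)) (hc : ∀ u ∈ Icc (0 : ℝ) 1, c u = L * u) :
    frechetDist σ c ≤ 1 / 4 ∧ frechetDist c σ ≤ 1 / 4 := by
  have hs' : (0 : ℝ) < s := by exact_mod_cast hs
  have hLpos : 0 < L := by linarith
  have key : ∀ η : ℝ, 0 < η → η ≤ 1 / 8 →
      frechetDist σ c ≤ 1 / 4 + η ∧ frechetDist c σ ≤ 1 / 4 + η := by
    intro η hη hη'
    obtain ⟨h, h0, h1, hlt, hnear⟩ := exists_increasing_near_zigzag hs hb hL hη hη'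
    have hknots : ∀ i < 2 * s + 1, h i / L < h (i + 1) / L := fun i hi =>
      div_lt_div_of_pos_right (hlt i (by omega)) hLpos
    have hcpoly : IsPolyOn c (2 * s + 2) (fun v => h v / L) h := by
      refine ⟨by omega, by simp [h0], ?_, fun i hi => hknots i (by omega), fun i hi u hu => ?_⟩
      · beta_reduce
        rw [show 2 * s + 2 - 1 = 2 * s + 1 by omega, h1, div_self hLpos.ne']
      · have hu0 : 0 ≤ h i / L := by
          have := knots_mono (t := fun v => h v / L) hknots (Nat.zero_le i) (by omega)
          simpa [h0] using this
        have hu1 : h (i + 1) / L ≤ 1 := by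
          have := knots_mono (t := fun v => h v / L) hknots (show i + 1 ≤ 2 * s + 1 by omega)
            le_rfl
          simpa [h1, div_self hLpos.ne'] using this
        rw [hc u ⟨hu0.trans hu.1, hu.2.trans hu1⟩]
        have hne : h (i + 1) - h i ≠ 0 := (sub_pos.mpr (hlt i (by omega))).ne'
        have : (u - h i / L) / (h (i + 1) / L - h i / L) * (h (i + 1) - h i) = L * u - h i := by
          rw [← sub_div]
          field_simp
        linarith
    refine ⟨hσ.frechetDist_le hcpoly fun v hv => hnear v (by omega),
      hcpoly.frechetDist_le hσ fun v hv => ?_⟩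
    rw [abs_sub_comm]
    exact hnear v (by omega)
  constructor <;> refine le_of_forall_pos_le_add fun ε hε => ?_
  · linarith [(key (min ε (1 / 8)) (lt_min hε (by norm_num)) (min_le_right _ _)).1,
      min_le_left ε (1 / 8)]
  · linarith [(key (min ε (1 / 8)) (lt_min hε (by norm_num)) (min_le_right _ _)).2,
      min_le_left ε (1 / 8)]

/-- A curve close to two zigzags, one entirely above the other, has at least `4 * s + 2`
vertices. -/
theorem lt_card_of_close_to_two_zigzags (hs : 0 < s) {b' : ℝ} (hb : 0 ≤ b) (hbb' : b + s ≤ b')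
    (hL : b' + s ≤ L) {σ' : ℝ → ℝ} {t' : ℕ → ℝ} (hσ : IsPolyOn σ (2 * s + 2) t (zigzag s b L))
    (hσ' : IsPolyOn σ' (2 * s + 2) t' (zigzag s b' L)) {z : ℝ → ℝ} {m : ℕ} {tz wz : ℕ → ℝ}
    (hz : IsPolyOn z m tz wz) (h : frechetDist z σ ≤ 1 / 8) (h' : frechetDist z σ' ≤ 1 / 8) :
    4 * s + 1 < m := by
  have hs' : (0 : ℝ) < s := by exact_mod_cast hs
  obtain ⟨f, hf, hfd⟩ := exists_reparam_of_frechetDist_lt hz.exists_abs_le hσ.exists_abs_le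
    (h.trans_lt (show (1 / 8 : ℝ) < 1 / 5 by norm_num))
  obtain ⟨g, hg, hgd⟩ := exists_reparam_of_frechetDist_lt hz.exists_abs_le hσ'.exists_abs_le
    (h'.trans_lt (show (1 / 8 : ℝ) < 1 / 5 by norm_num))
  have hfv : ∀ v ≤ 2 * s + 1, |z (f (t v)) - zigzag s b L v| < 1 / 5 := fun v hv => by
    rw [← hσ.apply_knot (show v < 2 * s + 2 by omega)]
    exact hfd _ (hσ.knot_mem (by omega))
  have hgv : ∀ v ≤ 2 * s + 1, |z (g (t' v)) - zigzag s b' L v| < 1 / 5 := fun v hv => by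
    rw [← hσ'.apply_knot (show v < 2 * s + 2 by omega)]
    exact hgd _ (hσ'.knot_mem (by omega))
  have hg1 := abs_lt.mp (hgv 1 (by omega))
  have hpeak := zigzag_peak (b := b') (L := L) hs
  simp only [mul_zero, zero_add, Nat.cast_zero, add_zero] at hpeak
  have hjoin : f (t (2 * s)) < g (t' 1) := by
    by_contra! hcon
    have hmem := hσ.knot_mem (show 2 * s < 2 * s + 2 by omega)
    have hg0 := (hg.mapsTo (hσ'.knot_mem (show 1 < 2 * s + 2 by omega))).1
    rw [← hf.2.2.1] at hg0
    obtain ⟨u, hu, hfu⟩ := intermediate_value_Icc hmem.1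
      (hf.1.mono (Icc_subset_Icc_right hmem.2)) ⟨hg0, hcon⟩
    have hle := hσ.le_of_vertices_le (show 0 < 2 * s by omega) (by omega)
      (fun v hv => zigzag_le hb hv) hu
    have hclose := abs_lt.mp (hfd u ⟨hu.1, hu.2.trans hmem.2⟩)
    rw [hfu] at hclose
    linarith [hclose.2, hg1.1]
  refine hz.lt_of_alternating (x := fun k => if k ≤ 2 * s then f (t k) else g (t' (k - 2 * s)))
    (by omega) ?_ ?_ ?_ ?_
  · intro k hk
    split_ifs with hk'
    · exact hf.mapsTo (hσ.knot_mem (by omega))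
    · exact hg.mapsTo (hσ'.knot_mem (by omega))
  · intro k hk
    rcases lt_trichotomy k (2 * s) with hk' | rfl | hk'
    · rw [if_pos (by omega), if_pos (by omega)]
      exact hf.2.1 (hσ.knot_mem (by omega)) (hσ.knot_mem (by omega)) (hσ.knots_lt k (by omega))
    · simpa using hjoin
    · rw [if_neg (by omega), if_neg (by omega), show k + 1 - 2 * s = k - 2 * s + 1 by omega]
      exact hg.2.1 (hσ'.knot_mem (by omega)) (hσ'.knot_mem (by omega))
        (hσ'.knots_lt _ (by omega))
  · intro k hk hp
    rcases lt_trichotomy k (2 * s) with hk' | rfl | hk'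
    · rw [if_pos (by omega), if_pos (by omega)]
      linarith [abs_lt.mp (hfv k (by omega)), abs_lt.mp (hfv (k + 1) (by omega)),
        zigzag_ascent hs hb (show b + s ≤ L by linarith) hk'.le hp]
    · have hval := abs_lt.mp (hfv (2 * s) (by omega))
      rw [if_pos le_rfl, if_neg (by omega), show 2 * s + 1 - 2 * s = 1 by omega]
      linarith [hval.2, hg1.1, zigzag_le (L := L) hb (le_refl (2 * s))]
    · rw [if_neg (by omega), if_neg (by omega), show k + 1 - 2 * s = k - 2 * s + 1 by omega]
      linarith [abs_lt.mp (hgv (k - 2 * s) (by omega)),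
        abs_lt.mp (hgv (k - 2 * s + 1) (by omega)),
        zigzag_ascent hs (show 0 ≤ b' by linarith) hL (show k - 2 * s ≤ 2 * s by omega)
          (show (k - 2 * s) % 2 = 0 by omega)]
  · intro k hk hp
    rcases lt_or_ge k (2 * s) with hk' | hk'
    · rw [if_pos (by omega), if_pos (by omega)]
      linarith [abs_lt.mp (hfv k (by omega)), abs_lt.mp (hfv (k + 1) (by omega)),
        zigzag_descent (b := b) (L := L) hk' hp]
    · rw [if_neg (by omega), if_neg (by omega), show k + 1 - 2 * s = k - 2 * s + 1 by omega]
      linarith [abs_lt.mp (hgv (k - 2 * s) (by omega)),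
        abs_lt.mp (hgv (k - 2 * s + 1) (by omega)),
        zigzag_descent (b := b') (L := L) (show k - 2 * s < 2 * s by omega)
          (show (k - 2 * s) % 2 = 1 by omega)]

end zigzag

/-- Lemma 8.4: fix `ℓ ≥ 4`, `d ≥ 1` and `s = ⌊(ℓ-2)/2⌋`. The
curves `τ i ∈ Δ_ℓ` (for `i = 1, …, 2^d + 1`) with vertex sequence
`(0, s(i-1)+1, s(i-1)+1/2, …, si, si - 1/2, s(2^d+2))` all lie within Fréchet
distance `1/4` of the segment `c` from `0` to `s(2^d+2)`, while no two distinct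
`τ i, τ j` are contained in a common ball of radius `1/8` with center in `Δ_ℓ`.
Consequently there is a closed ball of radius `1/4` in `(Δ_ℓ, d_F)` that cannot
be covered by `2^d` closed balls of radius `1/8` with centers in `Δ_ℓ`; hence the
doubling dimension of `(Δ_ℓ, d_F)` is unbounded for every `ℓ ≥ 4`. -/
theorem doubling_dimension_unbounded_bounded_complexity
    (ℓ : ℕ) (hℓ : 4 ≤ ℓ) (d : ℕ) (hd : 0 < d) (s : ℕ) (hs : s = (ℓ - 2) / 2)
    (τ : ℕ → ℝ → ℝ) (tτ : ℕ → ℕ → ℝ)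
    (hτ : ∀ i, 1 ≤ i → i ≤ 2 ^ d + 1 → IsPolyOn (τ i) (2 * s + 2) (tτ i)
      (fun v => if v = 0 then 0
        else if v = 2 * s + 1 then (s : ℝ) * ((2 : ℝ) ^ d + 2)
        else if v % 2 = 1 then (s : ℝ) * ((i : ℝ) - 1) + (((v + 1) / 2 : ℕ) : ℝ)
        else (s : ℝ) * ((i : ℝ) - 1) + ((v / 2 : ℕ) : ℝ) - 1 / 2))
    (c : ℝ → ℝ) (tc : ℕ → ℝ)
    (hc : IsPolyOn c 2 tc
      (fun v => if v = 0 then 0 else (s : ℝ) * ((2 : ℝ) ^ d + 2))) :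
    (∀ i, 1 ≤ i → i ≤ 2 ^ d + 1 → frechetDist (τ i) c ≤ 1 / 4) ∧
    (∀ i j, 1 ≤ i → i ≤ 2 ^ d + 1 → 1 ≤ j → j ≤ 2 ^ d + 1 → i ≠ j →
      ∀ z : ℝ → ℝ, InDeltaL ℓ z →
        ¬ (frechetDist z (τ i) ≤ 1 / 8 ∧ frechetDist z (τ j) ≤ 1 / 8)) ∧
    (∃ p : ℝ → ℝ, InDeltaL ℓ p ∧
      ∀ q : Fin (2 ^ d) → ℝ → ℝ, (∀ a, InDeltaL ℓ (q a)) →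
        ∃ z : ℝ → ℝ, InDeltaL ℓ z ∧ frechetDist p z ≤ 1 / 4 ∧
          ∀ a, 1 / 8 < frechetDist (q a) z) := by
  have hs0 : 0 < s := by omega
  have hs' : (0 : ℝ) < s := by exact_mod_cast hs0
  have hzig : ∀ i, 1 ≤ i → i ≤ 2 ^ d + 1 → IsPolyOn (τ i) (2 * s + 2) (tτ i)
      (zigzag s ((s : ℝ) * ((i : ℝ) - 1)) ((s : ℝ) * ((2 : ℝ) ^ d + 2))) := hτ
  have hb : ∀ i : ℕ, 1 ≤ i → 0 ≤ (s : ℝ) * ((i : ℝ) - 1) := fun i hi =>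
    mul_nonneg hs'.le (sub_nonneg.mpr (by exact_mod_cast hi))
  have hL : ∀ i : ℕ, i ≤ 2 ^ d + 1 →
      (s : ℝ) * ((i : ℝ) - 1) + s ≤ (s : ℝ) * ((2 : ℝ) ^ d + 2) := fun i hi => by
    have : (i : ℝ) ≤ 2 ^ d + 1 := by exact_mod_cast hi
    nlinarith
  have hseg : ∀ u ∈ Icc (0 : ℝ) 1, c u = (s : ℝ) * ((2 : ℝ) ^ d + 2) * u := by
    intro u hu
    have h0 : tc 0 = 0 := hc.2.1
    have h1 : tc (0 + 1) = 1 := hc.2.2.1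
    have h := hc.2.2.2.2 0 (by norm_num) u (by rwa [h0, h1])
    rw [h0, h1] at h
    rw [h]
    simp
    ring
  have hdist := fun i hi hi' =>
    frechetDist_zigzag_segment_le hs0 (hb i hi) (hL i hi') (hzig i hi hi') hseg
  have hsep_lt : ∀ i j, 1 ≤ i → j ≤ 2 ^ d + 1 → i < j → ∀ z : ℝ → ℝ, InDeltaL ℓ z →
      ¬ (frechetDist z (τ i) ≤ 1 / 8 ∧ frechetDist z (τ j) ≤ 1 / 8) := by
    rintro i j hi hj hij z ⟨m, tz, wz, hm, hz⟩ ⟨h1, h2⟩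
    have hij' : (i : ℝ) + 1 ≤ j := by exact_mod_cast hij
    have := lt_card_of_close_to_two_zigzags hs0 (hb i hi) (by nlinarith) (hL j hj)
      (hzig i hi (by omega)) (hzig j (by omega) hj) hz h1 h2
    omega
  have hsep : ∀ i j, 1 ≤ i → i ≤ 2 ^ d + 1 → 1 ≤ j → j ≤ 2 ^ d + 1 → i ≠ j →
      ∀ z : ℝ → ℝ, InDeltaL ℓ z →
        ¬ (frechetDist z (τ i) ≤ 1 / 8 ∧ frechetDist z (τ j) ≤ 1 / 8) := by
    intro i j hi hi' hj hj' hne z hz h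
    rcases hne.lt_or_gt with hlt | hlt
    · exact hsep_lt i j hi hj' hlt z hz h
    · exact hsep_lt j i hj hi' hlt z hz h.symm
  refine ⟨fun i hi hi' => (hdist i hi hi').1, hsep, c, ⟨2, tc, _, by omega, hc⟩, ?_⟩
  intro q hq
  by_contra! hcon
  have hcover : ∀ i : Fin (2 ^ d + 1), ∃ a, frechetDist (q a) (τ (i + 1)) ≤ 1 / 8 := fun i =>
    hcon (τ (i + 1)) ⟨2 * s + 2, tτ (i + 1), _, by omega, hzig (i + 1) (by omega) (by omega)⟩
      (hdist (i + 1) (by omega) (by omega)).2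
  choose a ha using hcover
  obtain ⟨i, j, hij, heq⟩ := Fintype.exists_ne_map_eq_of_card_lt a (by simp)
  have hne : (i : ℕ) + 1 ≠ j + 1 := fun h => hij (Fin.ext (by omega))
  exact hsep (i + 1) (j + 1) (by omega) (by omega) (by omega) (by omega) hne (q (a i)) (hq _)
    ⟨ha i, heq ▸ ha j⟩
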